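/- arXiv:2304.05267 — 2 statements merged into one kernel-verified Lean document; each statement's English description precedes it below -/
import Mathlib

section
/- Let Φ and Ψ be two finite simple graphs. The right-angled Artin groups A(Φ) and A(Ψ) are isomorphic as groups if and only if the graphs Φ and Ψ are isomorphic. -/
universe u v

/-- The defining relators of the right-angled Artin group of a simple graph. -/
def raagRels {V : Type u} (Γ : SimpleGraph V) : Set (FreeGroup V) :=
  {r | ∃ u v : V, Γ.Adj u v ∧
    r = FreeGroup.of u * FreeGroup.of v * (FreeGroup.of u)⁻¹ * (FreeGroup.of v)⁻¹}

/-- The right-angled Artin group of a simple graph. -/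
abbrev RAAG {V : Type u} (Γ : SimpleGraph V) : Type u := PresentedGroup (raagRels Γ)

open Matrix
open Equiv (Perm swap)

section Linear

variable {V : Type*}

/-- The closed star of a vertex. -/
abbrev closedStar (Γ : SimpleGraph V) (v : V) : Type _ := {u : V // u = v ∨ Γ.Adj v u}

/-- The columns of `M` indexed by adjacent vertices of `Γ` commute in the quadratic Lie algebra of
`Δ`: their `2 × 2` minors vanish on all pairs of distinct non-adjacent vertices of `Δ`. -/
def PreservesCommutation {W : Type*} (M : Matrix W V ℚ) (Γ : SimpleGraph V)
    (Δ : SimpleGraph W) : Prop :=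
  ∀ u v, Γ.Adj u v → ∀ s t, s ≠ t → ¬ Δ.Adj s t → M s u * M t v = M t u * M s v

variable [DecidableEq V] {Γ Δ : SimpleGraph V} {M N : Matrix V V ℚ} {σ : Perm V} {u v : V}

theorem mul_swap_ne_zero (hM : PreservesCommutation M Γ Δ) (hσ : ∀ v, M (σ v) v ≠ 0)
    (huv : Γ.Adj u v) (hbr : ¬ Δ.Adj (σ u) (σ v)) (a : V) : M ((σ * swap u v) a) a ≠ 0 := by
  have hminor := hM _ _ huv _ _ (σ.injective.ne huv.ne) hbr
  have hne := mul_ne_zero (hσ u) (hσ v)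
  rw [hminor] at hne
  rw [Perm.mul_apply]
  by_cases hau : a = u
  · subst hau; simpa using left_ne_zero_of_mul hne
  by_cases hav : a = v
  · subst hav; simpa using right_ne_zero_of_mul hne
  rw [Equiv.swap_apply_of_ne_of_ne hau hav]
  exact hσ a

theorem adj_mul_swap_iff (htwin : ∀ t, Δ.Adj (σ u) t ↔ Δ.Adj (σ v) t) (a b : V) :
    Δ.Adj ((σ * swap u v) a) ((σ * swap u v) b) ↔ Δ.Adj (σ a) (σ b) := by
  have hl : ∀ a t, Δ.Adj ((σ * swap u v) a) t ↔ Δ.Adj (σ a) t := fun a t => by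
    rw [Perm.mul_apply, Equiv.swap_apply_def]
    split_ifs with h1 h2
    · rw [h1, htwin]
    · rw [h2, htwin]
    · rfl
  rw [hl, Δ.adj_comm, hl, Δ.adj_comm]

variable [Fintype V]

open Classical in
/-- The restriction of `M` to the columns in the closed star of `v`, as a linear map. -/
noncomputable def starMap (M : Matrix V V ℚ) (Γ : SimpleGraph V) (v : V) :
    (closedStar Γ v → ℚ) →ₗ[ℚ] (V → ℚ) :=
  (M.submatrix id (Subtype.val : closedStar Γ v → V)).mulVecLin

open Classical in
theorem starMap_apply (M : Matrix V V ℚ) (Γ : SimpleGraph V) (v t : V)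
    (c : closedStar Γ v → ℚ) : starMap M Γ v c t = ∑ u, M t u.1 * c u := rfl

open Classical in
theorem starMap_injective (h : N * M = 1) (Γ : SimpleGraph V) (v : V) :
    Function.Injective (starMap M Γ v) := by
  have hs : N.submatrix (Subtype.val : closedStar Γ v → V) id *
      M.submatrix id (Subtype.val : closedStar Γ v → V) = 1 := by
    rw [← submatrix_mul _ _ _ _ _ Function.bijective_id, h,
      submatrix_one _ Subtype.val_injective]
  intro c d hcd
  have := congrArg (fun y => N.submatrix (Subtype.val : closedStar Γ v → V) id *ᵥ y) hcd
  simpa [starMap, mulVec_mulVec, hs] using this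

theorem starMap_commutes (hM : PreservesCommutation M Γ Δ) (v : V) (c : closedStar Γ v → ℚ)
    {s t : V} (hst : s ≠ t) (hadj : ¬ Δ.Adj s t) :
    M s v * starMap M Γ v c t = M t v * starMap M Γ v c s := by
  classical
  rw [starMap_apply, starMap_apply, Finset.mul_sum, Finset.mul_sum]
  refine Finset.sum_congr rfl fun u _ => ?_
  rcases u.2 with hu | hu
  · rw [hu]; ring
  · rw [← mul_assoc, hM _ _ hu _ _ hst hadj, mul_assoc]

theorem starMap_eq_zero (hM : PreservesCommutation M Γ Δ) {v w : V} (hw : M w v ≠ 0)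
    {c : closedStar Γ v → ℚ} (hc : starMap M Γ v c w = 0) {t : V}
    (ht : ¬ (t = w ∨ Δ.Adj w t)) : starMap M Γ v c t = 0 := by
  rw [not_or] at ht
  have := starMap_commutes hM v c (Ne.symm ht.1) ht.2
  rw [hc, mul_zero] at this
  exact (mul_eq_zero.1 this).resolve_left hw

/-- The restriction of a column combination to the rows in the closed star of `w`. -/
noncomputable def starRestrict (M : Matrix V V ℚ) (Γ Δ : SimpleGraph V) (v w : V) :
    (closedStar Γ v → ℚ) →ₗ[ℚ] (closedStar Δ w → ℚ) :=
  LinearMap.funLeft ℚ ℚ Subtype.val ∘ₗ starMap M Γ v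

theorem starRestrict_injective (h : N * M = 1) (hM : PreservesCommutation M Γ Δ) {v w : V}
    (hw : M w v ≠ 0) : Function.Injective (starRestrict M Γ Δ v w) := by
  refine (injective_iff_map_eq_zero _).2 fun c hc => ?_
  have hz : ∀ t : closedStar Δ w, starMap M Γ v c t.1 = 0 := fun t => congrFun hc t
  refine (injective_iff_map_eq_zero _).1 (starMap_injective h Γ v) c (funext fun t => ?_)
  by_cases ht : t = w ∨ Δ.Adj w t
  · exact hz ⟨t, ht⟩
  · exact starMap_eq_zero hM hw (hz ⟨w, Or.inl rfl⟩) ht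

theorem card_closedStar_le (h : N * M = 1) (hM : PreservesCommutation M Γ Δ) {v w : V}
    (hw : M w v ≠ 0) : Nat.card (closedStar Γ v) ≤ Nat.card (closedStar Δ w) := by
  classical
  simpa using LinearMap.finrank_le_finrank_of_injective (starRestrict_injective h hM hw)

theorem adj_of_card_closedStar_eq (h : N * M = 1) (hM : PreservesCommutation M Γ Δ) {v w : V}
    (hw : M w v ≠ 0) (hcard : Nat.card (closedStar Γ v) = Nat.card (closedStar Δ w))
    {s t : V} (hs : M s v ≠ 0) (ht : Δ.Adj w t) (hst : s ≠ t) : Δ.Adj s t := by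
  classical
  have hsurj : Function.Surjective (starRestrict M Γ Δ v w) :=
    (LinearMap.injective_iff_surjective_of_finrank_eq_finrank (by simpa using hcard)).1
      (starRestrict_injective h hM hw)
  obtain ⟨c, hc⟩ := hsurj (Pi.single ⟨t, Or.inr ht⟩ 1)
  have hval : ∀ r : closedStar Δ w, starMap M Γ v c r.1
      = (Pi.single (⟨t, Or.inr ht⟩ : closedStar Δ w) 1 : closedStar Δ w → ℚ) r :=
    fun r => congrFun hc r
  have ht1 : starMap M Γ v c t = 1 := by simpa using hval ⟨t, Or.inr ht⟩
  have hne : ∀ r : closedStar Δ w, r.1 ≠ t → starMap M Γ v c r.1 = 0 := fun r hr => by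
    rw [hval, Pi.single_eq_of_ne fun e => hr (congrArg Subtype.val e)]
  have hs0 : starMap M Γ v c s = 0 := by
    by_cases hsw : s = w ∨ Δ.Adj w s
    · exact hne ⟨s, hsw⟩ hst
    · exact starMap_eq_zero hM hw (hne ⟨w, Or.inl rfl⟩ ht.ne) hsw
  by_contra hadj
  have := starMap_commutes hM v c hst hadj
  rw [ht1, hs0, mul_zero, mul_one] at this
  exact hs this

theorem exists_perm_forall_ne_zero (h : N * M = 1) : ∃ σ : Perm V, ∀ v, M (σ v) v ≠ 0 := by
  classical
  by_contra! hσ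
  have hdet : M.det = 0 := by
    rw [det_apply]
    refine Finset.sum_eq_zero fun σ _ => ?_
    obtain ⟨v, hv⟩ := hσ σ
    rw [Finset.prod_eq_zero (f := fun i => M (σ i) i) (Finset.mem_univ v) hv, smul_zero]
  have := congrArg det h
  simp [hdet] at this

theorem sum_card_closedStar_le (h : N * M = 1) (hM : PreservesCommutation M Γ Δ) :
    ∑ v, Nat.card (closedStar Γ v) ≤ ∑ v, Nat.card (closedStar Δ v) := by
  obtain ⟨σ, hσ⟩ := exists_perm_forall_ne_zero h
  rw [← Equiv.sum_comp σ fun v => Nat.card (closedStar Δ v)]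
  exact Finset.sum_le_sum fun v _ => card_closedStar_le h hM (hσ v)

theorem card_closedStar_eq (h : N * M = 1) (hM : PreservesCommutation M Γ Δ)
    (hN : PreservesCommutation N Δ Γ) {σ : Perm V} (hσ : ∀ v, M (σ v) v ≠ 0) (v : V) :
    Nat.card (closedStar Γ v) = Nat.card (closedStar Δ (σ v)) := by
  classical
  have hle : ∀ v ∈ Finset.univ, Nat.card (closedStar Γ v) ≤ Nat.card (closedStar Δ (σ v)) :=
    fun v _ => card_closedStar_le h hM (hσ v)
  refine (Finset.sum_eq_sum_iff_of_le hle).1 ?_ v (Finset.mem_univ v)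
  rw [Equiv.sum_comp σ fun v => Nat.card (closedStar Δ v)]
  exact (sum_card_closedStar_le h hM).antisymm
    (sum_card_closedStar_le (mul_eq_one_comm.1 h) hN)

theorem prod_mul_swap (hM : PreservesCommutation M Γ Δ)
    (huv : Γ.Adj u v) (hbr : ¬ Δ.Adj (σ u) (σ v)) :
    ∏ a, M ((σ * swap u v) a) a = ∏ a, M (σ a) a := by
  have hminor := hM _ _ huv _ _ (σ.injective.ne huv.ne) hbr
  have hv : v ∈ Finset.univ.erase u := by simp [huv.ne']
  rw [← Finset.mul_prod_erase _ _ (Finset.mem_univ u), ← Finset.mul_prod_erase _ _ hv,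
    ← Finset.mul_prod_erase _ (fun a => M (σ a) a) (Finset.mem_univ u),
    ← Finset.mul_prod_erase _ (fun a => M (σ a) a) hv, ← mul_assoc, ← mul_assoc]
  congr 1
  · simpa using hminor.symm
  · refine Finset.prod_congr rfl fun a ha => ?_
    simp only [Finset.mem_erase, Finset.mem_univ, and_true] at ha
    rw [Perm.mul_apply, Equiv.swap_apply_of_ne_of_ne ha.2 ha.1]

theorem adj_iff_of_not_adj (h : N * M = 1) (hM : PreservesCommutation M Γ Δ)
    (hN : PreservesCommutation N Δ Γ) (hσ : ∀ v, M (σ v) v ≠ 0)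
    (huv : Γ.Adj u v) (hbr : ¬ Δ.Adj (σ u) (σ v)) (t : V) :
    Δ.Adj (σ u) t ↔ Δ.Adj (σ v) t := by
  classical
  have hminor := hM _ _ huv _ _ (σ.injective.ne huv.ne) hbr
  have hne := mul_ne_zero (hσ u) (hσ v)
  rw [hminor] at hne
  constructor <;> intro ht
  · exact adj_of_card_closedStar_eq h hM (hσ u) (card_closedStar_eq h hM hN hσ u)
      (left_ne_zero_of_mul hne) ht fun e => hbr (e ▸ ht)
  · exact adj_of_card_closedStar_eq h hM (hσ v) (card_closedStar_eq h hM hN hσ v)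
      (right_ne_zero_of_mul hne) ht fun e => hbr (e ▸ ht).symm

/-- A permutation in the support of `det M` that maps edges of `Γ` to edges of `Δ`: the terms of
the Leibniz expansion coming from all other permutations cancel in pairs. -/
theorem exists_perm_adj (h : N * M = 1) (hM : PreservesCommutation M Γ Δ)
    (hN : PreservesCommutation N Δ Γ) :
    ∃ σ : Perm V, (∀ v, M (σ v) v ≠ 0) ∧ ∀ u v, Γ.Adj u v → Δ.Adj (σ u) (σ v) := by
  classical
  by_contra! hσ
  let broken (σ : Perm V) : Set (V × V) := {p | Γ.Adj p.1 p.2 ∧ ¬ Δ.Adj (σ p.1) (σ p.2)}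
  obtain ⟨pick, hpick⟩ : ∃ pick : Set (V × V) → V × V, ∀ S, S.Nonempty → pick S ∈ S := by
    have : ∀ S : Set (V × V), ∃ p, S.Nonempty → p ∈ S := fun S => by
      by_cases hS : S.Nonempty
      · exact ⟨hS.some, fun _ => hS.some_mem⟩
      · obtain ⟨σ, hs⟩ := exists_perm_forall_ne_zero h
        obtain ⟨u, v, -⟩ := hσ σ hs
        exact ⟨(u, v), fun h => absurd h hS⟩
    exact Classical.skolem.1 this
  let move (σ : Perm V) : Perm V := σ * swap (pick (broken σ)).1 (pick (broken σ)).2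
  have hmem : ∀ σ : Perm V, (∀ v, M (σ v) v ≠ 0) → pick (broken σ) ∈ broken σ := fun σ hs => by
    obtain ⟨u, v, huv⟩ := hσ σ hs
    exact hpick _ ⟨(u, v), huv⟩
  have hinv : ∀ σ : Perm V, (∀ v, M (σ v) v ≠ 0) → broken (move σ) = broken σ := fun σ hs => by
    obtain ⟨h1, h2⟩ := hmem σ hs
    ext p
    exact and_congr_right fun _ =>
      not_congr (adj_mul_swap_iff (adj_iff_of_not_adj h hM hN hs h1 h2) p.1 p.2)
  have hsupp : ∀ σ : Perm V, Perm.sign σ • ∏ a, M (σ a) a ≠ 0 ↔ ∀ v, M (σ v) v ≠ 0 := fun σ => by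
    simp [Units.smul_def, Finset.prod_eq_zero_iff]
  have hdet : M.det = 0 := by
    rw [det_apply, ← Finset.sum_filter_ne_zero]
    refine Finset.sum_involution (fun σ _ => move σ) (fun σ hs => ?_) (fun σ hs _ => ?_)
      (fun σ hs => ?_) fun σ hs => ?_
    all_goals
      rw [Finset.mem_filter, hsupp] at hs
      obtain ⟨h1, h2⟩ := hmem σ hs.2
    · rw [prod_mul_swap hM h1 h2, Perm.sign_mul, Perm.sign_swap h1.ne]
      simp [Units.smul_def]
    · exact fun e => h1.ne (Equiv.swap_eq_one_iff.1 (mul_eq_left.1 e))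
    · rw [Finset.mem_filter, hsupp]
      exact ⟨Finset.mem_univ _, mul_swap_ne_zero hM hs.2 h1 h2⟩
    · change move σ * swap (pick (broken (move σ))).1 (pick (broken (move σ))).2 = σ
      rw [hinv σ hs.2, mul_assoc, Equiv.swap_mul_self, mul_one]
  have := congrArg det h
  simp [hdet] at this

/-- An invertible matrix that preserves commutation in both directions forces the graphs to be
isomorphic. -/
theorem nonempty_iso_of_preservesCommutation (h : N * M = 1) (hM : PreservesCommutation M Γ Δ)
    (hN : PreservesCommutation N Δ Γ) : Nonempty (Γ ≃g Δ) := by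
  classical
  obtain ⟨σ, hσ, hadj⟩ := exists_perm_adj h hM hN
  refine ⟨σ, fun {a b} => ⟨fun hab => ?_, hadj a b⟩⟩
  let f (x : closedStar Γ a) : closedStar Δ (σ a) :=
    ⟨σ x.1, x.2.imp (congrArg σ) (hadj a x.1)⟩
  have hf : Function.Injective f := fun x y hxy =>
    Subtype.ext (σ.injective (congrArg Subtype.val hxy))
  have hcard := card_closedStar_eq h hM hN hσ a
  rw [Nat.card_eq_fintype_card, Nat.card_eq_fintype_card] at hcard
  obtain ⟨x, hx⟩ := ((Fintype.bijective_iff_injective_and_card f).2 ⟨hf, hcard⟩).2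
    ⟨σ b, Or.inr hab⟩
  have hxb : x.1 = b := σ.injective (congrArg Subtype.val hx)
  rcases x.2 with hxa | hxa
  · exact absurd hab (by rw [← hxb, hxa]; exact Δ.irrefl)
  · exact hxb ▸ hxa

end Linear

/-- The rational Heisenberg group. -/
@[ext]
structure Heisenberg where
  /-- First abelian coordinate. -/
  x : ℚ
  /-- Second abelian coordinate. -/
  y : ℚ
  /-- Central coordinate. -/
  z : ℚ

namespace Heisenberg

instance : Mul Heisenberg := ⟨fun a b => ⟨a.x + b.x, a.y + b.y, a.z + b.z + a.x * b.y⟩⟩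
instance : One Heisenberg := ⟨⟨0, 0, 0⟩⟩
instance : Inv Heisenberg := ⟨fun a => ⟨-a.x, -a.y, -a.z + a.x * a.y⟩⟩

@[simp] theorem mul_x (a b : Heisenberg) : (a * b).x = a.x + b.x := rfl
@[simp] theorem mul_y (a b : Heisenberg) : (a * b).y = a.y + b.y := rfl
@[simp] theorem mul_z (a b : Heisenberg) : (a * b).z = a.z + b.z + a.x * b.y := rfl
@[simp] theorem one_x : (1 : Heisenberg).x = 0 := rfl
@[simp] theorem one_y : (1 : Heisenberg).y = 0 := rfl
@[simp] theorem one_z : (1 : Heisenberg).z = 0 := rfl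
@[simp] theorem inv_x (a : Heisenberg) : (a⁻¹).x = -a.x := rfl
@[simp] theorem inv_y (a : Heisenberg) : (a⁻¹).y = -a.y := rfl
@[simp] theorem inv_z (a : Heisenberg) : (a⁻¹).z = -a.z + a.x * a.y := rfl

instance : Group Heisenberg :=
  Group.ofLeftAxioms
    (fun a b c => by ext <;> simp <;> ring)
    (fun a => by ext <;> simp)
    (fun a => by ext <;> simp)

/-- The first coordinate as a homomorphism. -/
def xHom : Heisenberg →* Multiplicative ℚ where
  toFun a := Multiplicative.ofAdd a.x
  map_one' := rfl
  map_mul' _ _ := rfl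

/-- The second coordinate as a homomorphism. -/
def yHom : Heisenberg →* Multiplicative ℚ where
  toFun a := Multiplicative.ofAdd a.y
  map_one' := rfl
  map_mul' _ _ := rfl

theorem commute_iff (a b : Heisenberg) : Commute a b ↔ a.x * b.y = b.x * a.y := by
  rw [Commute, SemiconjBy, Heisenberg.ext_iff]
  simp only [mul_x, mul_y, mul_z]
  constructor
  · rintro ⟨-, -, h⟩
    linarith
  · intro h
    exact ⟨add_comm _ _, add_comm _ _, by linarith⟩

end Heisenberg

namespace RAAG

variable {V : Type*} {Γ : SimpleGraph V}

/-- The universal property: a map whose values on adjacent vertices commute extends to the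
right-angled Artin group. -/
def lift {G : Type*} [Group G] (f : V → G) (hf : ∀ u v, Γ.Adj u v → Commute (f u) (f v)) :
    RAAG Γ →* G :=
  PresentedGroup.toGroup (f := f) (by
    rintro _ ⟨u, v, huv, rfl⟩
    simpa [mul_inv_eq_one, mul_inv_eq_iff_eq_mul] using (hf u v huv).eq)

@[simp]
theorem lift_of {G : Type*} [Group G] (f : V → G)
    (hf : ∀ u v, Γ.Adj u v → Commute (f u) (f v)) (v : V) :
    lift f hf (PresentedGroup.of v) = f v :=
  PresentedGroup.toGroup.of _

theorem commute_of {u v : V} (huv : Γ.Adj u v) :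
    Commute (PresentedGroup.of u : RAAG Γ) (PresentedGroup.of v) := by
  have := PresentedGroup.one_of_mem (rels := raagRels Γ) ⟨u, v, huv, rfl⟩
  simp only [map_mul, map_inv, mul_inv_eq_iff_eq_mul, one_mul] at this
  exact this

/-- The homomorphism induced by a graph homomorphism. -/
def map {W : Type*} {Δ : SimpleGraph W} (f : Γ →g Δ) : RAAG Γ →* RAAG Δ :=
  lift (fun v => PresentedGroup.of (f v)) fun _ _ huv => commute_of (f.map_adj huv)

/-- The isomorphism induced by a graph isomorphism. -/
def congr {W : Type*} {Δ : SimpleGraph W} (e : Γ ≃g Δ) : RAAG Γ ≃* RAAG Δ :=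
  MonoidHom.toMulEquiv (map e.toHom) (map e.symm.toHom)
    (PresentedGroup.ext fun v => by simp [map])
    (PresentedGroup.ext fun v => by simp [map])

open Classical in
/-- The exponent sum of a vertex, with rational values. -/
noncomputable def exponent (Γ : SimpleGraph V) (v : V) : RAAG Γ →* Multiplicative ℚ :=
  lift (fun u => Multiplicative.ofAdd (if u = v then 1 else 0)) fun _ _ _ => Commute.all _ _

open Classical in
theorem exponent_of (Γ : SimpleGraph V) (u v : V) :
    (exponent Γ v (PresentedGroup.of u)).toAdd = if u = v then 1 else 0 := by
  simp [exponent]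

theorem exponent_mul_eq_of_commute {s t : V} (hst : s ≠ t) (hadj : ¬ Γ.Adj s t)
    {a b : RAAG Γ} (hab : Commute a b) :
    (exponent Γ s a).toAdd * (exponent Γ t b).toAdd =
      (exponent Γ t a).toAdd * (exponent Γ s b).toAdd := by
  classical
  let f (u : V) : Heisenberg := ⟨if u = s then 1 else 0, if u = t then 1 else 0, 0⟩
  have hf : ∀ u v, Γ.Adj u v → Commute (f u) (f v) := by
    intro u v huv
    rw [Heisenberg.commute_iff]
    have h1 : ¬ (u = s ∧ v = t) := by rintro ⟨rfl, rfl⟩; exact hadj huv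
    have h2 : ¬ (v = s ∧ u = t) := by rintro ⟨rfl, rfl⟩; exact hadj huv.symm
    simp only [f, mul_ite, mul_one, mul_zero]
    grind
  have hx : Heisenberg.xHom.comp (lift f hf) = exponent Γ s :=
    PresentedGroup.ext fun v => by simp [f, exponent, Heisenberg.xHom]
  have hy : Heisenberg.yHom.comp (lift f hf) = exponent Γ t :=
    PresentedGroup.ext fun v => by simp [f, exponent, Heisenberg.yHom]
  have := (Heisenberg.commute_iff _ _).1 (hab.map (lift f hf))
  rw [← hx, ← hy, mul_comm (Multiplicative.toAdd ((Heisenberg.yHom.comp (lift f hf)) a))]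
  exact this

variable {W : Type*} {Δ : SimpleGraph W}

/-- The matrix of a homomorphism on rational abelianizations. -/
noncomputable def abMatrix (φ : RAAG Γ →* RAAG Δ) : Matrix W V ℚ :=
  fun w v => (exponent Δ w (φ (PresentedGroup.of v))).toAdd

theorem preservesCommutation_abMatrix (φ : RAAG Γ →* RAAG Δ) :
    PreservesCommutation (abMatrix φ) Γ Δ :=
  fun _ _ huv _ _ hst hadj => exponent_mul_eq_of_commute hst hadj ((commute_of huv).map φ)

theorem exponent_apply [Fintype V] (φ : RAAG Γ →* RAAG Δ) (w : W) (g : RAAG Γ) :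
    (exponent Δ w (φ g)).toAdd = ∑ v, abMatrix φ w v * (exponent Γ v g).toAdd := by
  classical
  let ψ : RAAG Γ →* Multiplicative ℚ :=
    { toFun g := Multiplicative.ofAdd (∑ v, abMatrix φ w v * (exponent Γ v g).toAdd)
      map_one' := by simp
      map_mul' a b := by simp [mul_add, Finset.sum_add_distrib] }
  have : (exponent Δ w).comp φ = ψ :=
    PresentedGroup.ext fun v => Multiplicative.toAdd.injective <| by
      simp [ψ, exponent_of, abMatrix]
  exact congrArg Multiplicative.toAdd (DFunLike.congr_fun this g)

open Classical in
theorem abMatrix_mul_of_leftInverse [Fintype W] {φ : RAAG Γ →* RAAG Δ} {ψ : RAAG Δ →* RAAG Γ}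
    (h : Function.LeftInverse ψ φ) : abMatrix ψ * abMatrix φ = 1 := by
  ext u v
  have := exponent_apply ψ u (φ (PresentedGroup.of v))
  rw [h] at this
  rw [mul_apply]
  refine this.symm.trans ?_
  simp [exponent_of, one_apply, eq_comm]

end RAAG

/-- Two RAAGs over finite graphs are isomorphic as groups iff the graphs are
isomorphic. -/
theorem raag_iso_iff_graph_iso {VΦ : Type u} {VΨ : Type v} [Fintype VΦ] [Fintype VΨ]
    (Φ : SimpleGraph VΦ) (Ψ : SimpleGraph VΨ) :
    Nonempty (RAAG Φ ≃* RAAG Ψ) ↔ Nonempty (Φ ≃g Ψ) := by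
  classical
  refine ⟨fun ⟨φ⟩ => ?_, fun ⟨e⟩ => ⟨RAAG.congr e⟩⟩
  set M := RAAG.abMatrix φ.toMonoidHom
  set N := RAAG.abMatrix φ.symm.toMonoidHom
  have hNM : N * M = 1 := RAAG.abMatrix_mul_of_leftInverse φ.symm_apply_apply
  have hMN : M * N = 1 := RAAG.abMatrix_mul_of_leftInverse φ.apply_symm_apply
  obtain ⟨e⟩ : Nonempty (VΦ ≃ VΨ) :=
    Fintype.card_eq.1 (square_of_invertible N M hNM hMN)
  have hNM' : N.submatrix id e * M.submatrix e id = 1 := by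
    rw [submatrix_mul_equiv, hNM, submatrix_id_id]
  obtain ⟨f⟩ := nonempty_iso_of_preservesCommutation (Γ := Φ) (Δ := Ψ.comap e) hNM'
    (fun u v huv s t hst hadj => RAAG.preservesCommutation_abMatrix _ u v huv _ _
      (e.injective.ne hst) hadj)
    (fun u v huv s t hst hadj =>
      RAAG.preservesCommutation_abMatrix φ.symm.toMonoidHom _ _ huv s t hst hadj)
  exact ⟨f.trans (SimpleGraph.Iso.comap e Ψ)⟩
end

section
/- Let Γ be a simple graph and, for every vertex u of Γ, fix a nonzero integer p(u). Then the map sending each generator u to u^{p(u)} extends to an injective group homomorphism A(Γ) → A(Γ); in particular, the subgroup ⟨ u^{p(u)} : u ∈ V(Γ) ⟩ of A(Γ) is isomorphic to A(Γ). -/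
universe u

/-- The generator of `RAAG Γ` corresponding to a vertex. -/
def raagGen {V : Type u} (Γ : SimpleGraph V) (u : V) : RAAG Γ :=
  PresentedGroup.of (rels := raagRels Γ) u

namespace HNNExtension

variable {G : Type*} [Group G] {A : Subgroup G}

theorem mem_toSubgroup_self (u : ℤˣ) (g : G) : g ∈ toSubgroup A A u ↔ g ∈ A := by
  rcases Int.units_eq_one_or u with rfl | rfl <;> rfl

/-- Every element of an HNN extension is the product of a reduced word. -/
theorem exists_reducedWord_prod_eq {B : Subgroup G} {φ : A ≃* B} (x : HNNExtension G A B φ) :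
    ∃ w : NormalWord.ReducedWord G A B, w.prod φ = x := by
  obtain ⟨d⟩ := NormalWord.TransversalPair.nonempty G A B
  exact ⟨((NormalWord.equiv φ d) x).toReducedWord, (NormalWord.equiv φ d).symm_apply_apply x⟩

/-- Prepending copies of `t ^ u` to a reduced list beginning with `t ^ u` keeps it reduced. -/
theorem isChain_replicate_append (u : ℤˣ) (n : ℕ) (l : List (ℤˣ × G))
    (hl : l.IsChain (fun a b => a.2 ∈ toSubgroup A A a.1 → a.1 = b.1))
    (hu : l.head?.map Prod.fst = some u) :
    (List.replicate n (u, (1 : G)) ++ l).IsChain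
        (fun a b => a.2 ∈ toSubgroup A A a.1 → a.1 = b.1) ∧
      (List.replicate n (u, (1 : G)) ++ l).head?.map Prod.fst = some u := by
  induction n with
  | zero => simpa using ⟨hl, by simpa using hu⟩
  | succ n ih =>
    rw [List.replicate_succ, List.cons_append]
    refine ⟨List.isChain_cons.2 ⟨fun y hy _ => ?_, ih.1⟩, rfl⟩
    have h := ih.2
    rw [Option.mem_def.1 hy] at h
    simpa using h.symm

/-- An endomorphism of an HNN extension with trivially acting stable letter that sends the stable
letter to a nonzero power and is injective on the base group, with the associated subgroup
as the preimage of itself, is injective. -/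
theorem injective_of_map_t_eq_zpow
    (F : HNNExtension G A A (MulEquiv.refl A) →* HNNExtension G A A (MulEquiv.refl A))
    (f : G →* G) (hf : Function.Injective f) (hfA : ∀ g, f g ∈ A → g ∈ A) {p : ℤ} (hp : p ≠ 0)
    (hFof : ∀ g, F (of g) = of (f g)) (hFt : F t = t ^ p) : Function.Injective F := by
  obtain ⟨s, n, rfl⟩ : ∃ (s : ℤˣ) (n : ℕ), p = s * (n + 1) := by
    rcases lt_or_gt_of_ne hp with h | h
    · exact ⟨-1, (-p - 1).toNat, by push_cast; omega⟩
    · exact ⟨1, (p - 1).toNat, by push_cast; omega⟩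
  have key : ∀ l : List (ℤˣ × G),
      l.IsChain (fun a b => a.2 ∈ toSubgroup A A a.1 → a.1 = b.1) →
      ∃ l' : List (ℤˣ × G),
        l'.IsChain (fun a b => a.2 ∈ toSubgroup A A a.1 → a.1 = b.1) ∧
        l'.head?.map Prod.fst = l.head?.map (fun a => s * a.1) ∧
        (l'.map fun x => (t ^ (x.1 : ℤ) * of x.2 :
          HNNExtension G A A (MulEquiv.refl A))).prod =
        F (l.map fun x => t ^ (x.1 : ℤ) * of x.2).prod := by
    intro l hl
    induction l with
    | nil => exact ⟨[], List.isChain_nil, rfl, by simp⟩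
    | cons a l ih =>
      obtain ⟨hal, hl⟩ := List.isChain_cons.1 hl
      obtain ⟨l', hl', hhead, hprod⟩ := ih hl
      obtain ⟨hchain, hfst⟩ := isChain_replicate_append (A := A) (s * a.1) n
        ((s * a.1, f a.2) :: l')
        (List.isChain_cons.2 ⟨fun y hy hmem => by
          rw [Option.mem_def.1 hy] at hhead
          rcases l with _ | ⟨b, l⟩
          · simp at hhead
          · have hb := hal b rfl ((mem_toSubgroup_self _ _).2
              (hfA _ ((mem_toSubgroup_self _ _).1 hmem)))
            have : y.1 = s * b.1 := by simpa using hhead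
            simp [this, hb], hl'⟩) rfl
      refine ⟨_, hchain, hfst, ?_⟩
      simp only [List.map_append, List.map_replicate, List.prod_append, List.prod_replicate,
        List.map_cons, List.prod_cons, map_mul, map_zpow, hFof, hFt, hprod, map_one, mul_one,
        ← mul_assoc]
      congr 2
      rw [← zpow_natCast, ← zpow_mul, ← zpow_add, ← zpow_mul]
      congr 1
      push_cast
      ring
  rw [injective_iff_map_eq_one]
  intro x hx
  obtain ⟨w, rfl⟩ := exists_reducedWord_prod_eq x
  obtain ⟨l', hl', hhead, hprod⟩ := key w.toList w.chain
  have hw' : (⟨f w.head, l', hl'⟩ : NormalWord.ReducedWord G A A).prod (MulEquiv.refl A) = 1 := by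
    rw [← hx]
    simp only [NormalWord.ReducedWord.prod, hprod, map_mul, hFof]
  have hnil : l' = [] := ReducedWord.toList_eq_nil_of_mem_of_range (MulEquiv.refl A)
    ⟨f w.head, l', hl'⟩ (hw' ▸ one_mem _)
  have hwnil : w.toList = [] := by
    rw [hnil] at hhead
    simpa using hhead.symm
  have hwprod : w.prod (MulEquiv.refl A) = of w.head := by
    simp [NormalWord.ReducedWord.prod, hwnil]
  rw [hwprod, hFof] at hx
  rw [hwprod, hf ((of_injective (MulEquiv.refl A) (hx.trans (map_one _).symm)).trans
    (map_one f).symm), map_one]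

end HNNExtension

section RAAG

variable {V : Type u} (Γ : SimpleGraph V)

theorem raagGen_commute {u v : V} (h : Γ.Adj u v) : Commute (raagGen Γ u) (raagGen Γ v) := by
  have h1 : PresentedGroup.mk (raagRels Γ) (FreeGroup.of u * FreeGroup.of v *
      (FreeGroup.of u)⁻¹ * (FreeGroup.of v)⁻¹) = 1 :=
    (QuotientGroup.eq_one_iff _).2 (Subgroup.subset_normalClosure ⟨u, v, h, rfl⟩)
  rw [map_mul, map_mul, map_mul, map_inv, map_inv] at h1
  exact mul_inv_eq_iff_eq_mul.1 (mul_inv_eq_one.1 h1)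

/-- The universal property of a right-angled Artin group. -/
theorem exists_raagLift {H : Type*} [Group H] (k : V → H)
    (hk : ∀ u v, Γ.Adj u v → Commute (k u) (k v)) :
    ∃ F : RAAG Γ →* H, ∀ u, F (raagGen Γ u) = k u := by
  refine ⟨PresentedGroup.toGroup (f := k) ?_, fun u => PresentedGroup.toGroup.of _⟩
  rintro _ ⟨u, v, h, rfl⟩
  simpa [mul_inv_eq_one, mul_inv_eq_iff_eq_mul] using (hk u v h).eq

/-- The subgroup of `RAAG Γ` generated by a set of vertices. -/
def raagSpecial (S : Set V) : Subgroup (RAAG Γ) := Subgroup.closure (raagGen Γ '' S)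

variable {Γ}

theorem raagGen_mem_special {S : Set V} {u : V} (h : u ∈ S) : raagGen Γ u ∈ raagSpecial Γ S :=
  Subgroup.subset_closure ⟨u, h, rfl⟩

theorem raagSpecial_mono {S T : Set V} (h : S ⊆ T) : raagSpecial Γ S ≤ raagSpecial Γ T :=
  Subgroup.closure_mono (Set.image_mono h)

theorem exists_finite_mem_raagSpecial (x : RAAG Γ) :
    ∃ S : Set V, S.Finite ∧ x ∈ raagSpecial Γ S := by
  have hx : x ∈ Subgroup.closure (Set.range (PresentedGroup.of (rels := raagRels Γ))) := by
    simp [PresentedGroup.closure_range_of]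
  induction hx using Subgroup.closure_induction with
  | mem x hx =>
    obtain ⟨u, rfl⟩ := hx
    exact ⟨{u}, Set.finite_singleton u, raagGen_mem_special rfl⟩
  | one => exact ⟨∅, Set.finite_empty, one_mem _⟩
  | mul x y _ _ ihx ihy =>
    obtain ⟨S, hS, hxS⟩ := ihx
    obtain ⟨T, hT, hyT⟩ := ihy
    exact ⟨S ∪ T, hS.union hT, mul_mem (raagSpecial_mono Set.subset_union_left hxS)
      (raagSpecial_mono Set.subset_union_right hyT)⟩
  | inv x _ ih =>
    obtain ⟨S, hS, hxS⟩ := ih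
    exact ⟨S, hS, inv_mem hxS⟩

variable {f : RAAG Γ →* RAAG Γ} {p : V → ℤ}

theorem raagPower_mem_special
    (hf : ∀ u, f (raagGen Γ u) = raagGen Γ u ^ p u)
    {S : Set V} {x : RAAG Γ} (hx : x ∈ raagSpecial Γ S) :
    f x ∈ raagSpecial Γ S := by
  have : raagSpecial Γ S ≤ (raagSpecial Γ S).comap f := by
    refine (Subgroup.closure_le _).2 ?_
    rintro _ ⟨u, hu, rfl⟩
    simpa [hf] using zpow_mem (raagGen_mem_special hu) (p u)
  exact this hx

open Classical in
/-- If the power map is injective on `raagSpecial Γ S`, then it pulls back special subgroups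
of `raagSpecial Γ S` to themselves, because it commutes with the canonical retractions. -/
theorem mem_raagSpecial_of_raagPower_mem
    (hf : ∀ u, f (raagGen Γ u) = raagGen Γ u ^ p u)
    {S T : Set V} (hTS : T ⊆ S)
    (hinj : ∀ x ∈ raagSpecial Γ S, f x = 1 → x = 1) {x : RAAG Γ} (hx : x ∈ raagSpecial Γ S)
    (hfx : f x ∈ raagSpecial Γ T) : x ∈ raagSpecial Γ T := by
  obtain ⟨ρ, hρ⟩ := exists_raagLift Γ (fun u => if u ∈ T then raagGen Γ u else 1) (by
    intro u v h
    split_ifs <;> simp [raagGen_commute Γ h])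
  have hρf : ρ.comp f = f.comp ρ := by
    refine PresentedGroup.ext fun u => ?_
    change ρ (f (raagGen Γ u)) = f (ρ (raagGen Γ u))
    by_cases hu : u ∈ T <;> simp [hf, hρ, hu]
  have hρid : Set.EqOn ρ (MonoidHom.id _) (raagSpecial Γ T) := by
    refine MonoidHom.eqOn_closure ?_
    rintro _ ⟨u, hu, rfl⟩
    simp [hρ, hu]
  have hρmem : ρ x ∈ raagSpecial Γ T := by
    have : raagSpecial Γ S ≤ (raagSpecial Γ T).comap ρ := by
      refine (Subgroup.closure_le _).2 ?_
      rintro _ ⟨u, -, rfl⟩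
      by_cases hu : u ∈ T
      · simpa [hρ, hu] using raagGen_mem_special hu
      · simp [hρ, hu]
    exact this hx
  have h1 : f (ρ x) = f x := (DFunLike.congr_fun hρf x).symm.trans (hρid hfx)
  have h2 : ρ x * x⁻¹ = 1 := hinj _
    (mul_mem (raagSpecial_mono hTS hρmem) (inv_mem hx)) (by simp [h1])
  rwa [← mul_inv_eq_one.1 h2]

open Classical in
theorem raagPower_eq_one_insert
    (hf : ∀ u, f (raagGen Γ u) = raagGen Γ u ^ p u)
    (hp : ∀ u, p u ≠ 0) {S : Set V} {v : V} (hv : v ∉ S)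
    (hinj : ∀ x ∈ raagSpecial Γ S, f x = 1 → x = 1) :
    ∀ x ∈ raagSpecial Γ (insert v S), f x = 1 → x = 1 := by
  let T : Set V := {u ∈ S | Γ.Adj v u}
  let G := raagSpecial Γ S
  let A : Subgroup G := (raagSpecial Γ T).subgroupOf G
  let E := HNNExtension G A A (MulEquiv.refl A)
  have hcomm : ∀ a ∈ raagSpecial Γ T, Commute (raagGen Γ v) a := by
    have : raagSpecial Γ T ≤ Subgroup.centralizer {raagGen Γ v} := by
      refine (Subgroup.closure_le _).2 ?_
      rintro _ ⟨u, hu, rfl⟩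
      exact Subgroup.mem_centralizer_singleton_iff.2 (raagGen_commute Γ hu.2).symm.eq
    exact fun a ha => (Subgroup.mem_centralizer_singleton_iff.1 (this ha)).symm
  let ψ : E →* RAAG Γ := HNNExtension.lift G.subtype (raagGen Γ v) fun a => (hcomm _ a.2).eq
  have hψt : ψ HNNExtension.t = raagGen Γ v := HNNExtension.lift_t _ _ _
  have hψof (g : G) : ψ (HNNExtension.of g) = g := HNNExtension.lift_of _ _ _ g
  have htcomm (u : V) (hu : u ∈ S) (h : Γ.Adj v u) :
      Commute (HNNExtension.t : E) (HNNExtension.of ⟨_, raagGen_mem_special hu⟩) :=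
    HNNExtension.t_mul_of (φ := MulEquiv.refl A)
      ⟨⟨_, raagGen_mem_special hu⟩, raagGen_mem_special ⟨hu, h⟩⟩
  obtain ⟨φ, hφ⟩ := exists_raagLift Γ (H := E)
    (fun u => if hu : u ∈ S then HNNExtension.of ⟨raagGen Γ u, raagGen_mem_special hu⟩
      else if u = v then HNNExtension.t else 1) (by
    intro u w h
    split_ifs with hu hw hw hw hu
    · exact Commute.map (Subtype.ext (raagGen_commute Γ h).eq) HNNExtension.of
    · subst hw
      exact (htcomm u hu h.symm).symm
    · exact Commute.one_right _
    · subst hw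
      exact htcomm w hu h
    all_goals simp)
  have hφG (g : G) : φ g = HNNExtension.of g := by
    obtain ⟨g, hg⟩ := g
    induction hg using Subgroup.closure_induction with
    | mem x hx =>
      obtain ⟨u, hu, rfl⟩ := hx
      simp [hφ, hu]
    | one => exact (map_one φ).trans (map_one HNNExtension.of).symm
    | mul x y hx hy ihx ihy =>
      exact (map_mul φ x y).trans ((congrArg₂ _ ihx ihy).trans
        (map_mul HNNExtension.of (⟨x, hx⟩ : G) ⟨y, hy⟩).symm)
    | inv x hx ih =>
      exact (map_inv φ x).trans ((congrArg _ ih).trans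
        (map_inv HNNExtension.of (⟨x, hx⟩ : G)).symm)
  let f₀ : G →* G := (f.comp G.subtype).codRestrict G fun x => raagPower_mem_special hf x.2
  have hF : Function.Injective ((φ.comp f).comp ψ) := by
    refine HNNExtension.injective_of_map_t_eq_zpow _ f₀ ?_ ?_ (hp v) (fun g => ?_) ?_
    · refine (injective_iff_map_eq_one _).2 fun x hx => Subtype.ext ?_
      exact hinj x x.2 (congrArg Subtype.val hx)
    · exact fun g hg => mem_raagSpecial_of_raagPower_mem hf (Set.sep_subset _ _) hinj g.2 hg
    · simp only [MonoidHom.comp_apply, hψof]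
      exact hφG (f₀ g)
    · simp [hψt, hf, hφ, hv]
  intro x hx hfx
  have hrange : raagSpecial Γ (insert v S) ≤ ψ.range := by
    refine (Subgroup.closure_le _).2 ?_
    rintro _ ⟨u, rfl | hu, rfl⟩
    · exact ⟨_, hψt⟩
    · exact ⟨_, hψof ⟨_, raagGen_mem_special hu⟩⟩
  obtain ⟨y, rfl⟩ := hrange hx
  rw [(injective_iff_map_eq_one _).1 hF y (by simp [hfx]), map_one]

theorem raagPower_injective
    (hf : ∀ u, f (raagGen Γ u) = raagGen Γ u ^ p u)
    (hp : ∀ u, p u ≠ 0) : Function.Injective f := by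
  refine (injective_iff_map_eq_one f).2 fun x hx => ?_
  obtain ⟨S, hS, hxS⟩ := exists_finite_mem_raagSpecial x
  suffices ∀ x ∈ raagSpecial Γ S, f x = 1 → x = 1 from this x hxS hx
  clear hxS
  induction S, hS using Set.Finite.induction_on with
  | empty => simp [raagSpecial]
  | insert hv _ ih => exact raagPower_eq_one_insert hf hp hv ih

end RAAG

/-- Sending each generator `u` to `u^{p(u)}` (with `p(u) ≠ 0`) induces an injective
endomorphism of `A(Γ)`; in particular, the subgroup `⟨u^{p(u)} : u ∈ V(Γ)⟩` is
isomorphic to `A(Γ)`. -/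
theorem raag_powers_embed {V : Type u} (Γ : SimpleGraph V) (p : V → ℤ)
    (hp : ∀ u, p u ≠ 0) :
    (∃ f : RAAG Γ →* RAAG Γ, Function.Injective f ∧
      ∀ u : V, f (raagGen Γ u) = raagGen Γ u ^ p u) ∧
    Nonempty (RAAG Γ ≃*
      Subgroup.closure {x : RAAG Γ | ∃ u : V, x = raagGen Γ u ^ p u}) := by
  obtain ⟨f, hf⟩ := exists_raagLift Γ (fun u => raagGen Γ u ^ p u)
    fun u v h => (raagGen_commute Γ h).zpow_zpow _ _
  have hinj := raagPower_injective hf hp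
  refine ⟨⟨f, hinj, hf⟩, ?_⟩
  have hrange : f.range = Subgroup.closure {x : RAAG Γ | ∃ u : V, x = raagGen Γ u ^ p u} := by
    rw [MonoidHom.range_eq_map, ← PresentedGroup.closure_range_of, MonoidHom.map_closure,
      ← Set.range_comp]
    congr 1
    ext x
    exact exists_congr fun u => (hf u).congr_left.trans eq_comm
  exact ⟨(MonoidHom.ofInjective hinj).trans (MulEquiv.subgroupCongr hrange)⟩
end
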